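/- arXiv:2508.19041 — 2 statements merged into one kernel-verified Lean document; each statement's English description precedes it below -/
import Mathlib

section
/- In Ω̃₂ (notation of the context), for all t, v, a ∈ T one has Θ(t, 1, va, 1) = Θ(at, 1, v, 1). (Lemma 3.2(2) of the paper, transported through the presentation of the 2-loop space Ω̃₂ given by Theorem 1.1: a hair bundle on the left cycle of a theta graph may be slid from the top strand to the bottom strand.) -/
open TensorProduct

set_option maxSynthPendingDepth 4

noncomputable section

/-- The symplectic vector space `H = ℚ^{2g}`. -/
abbrev Hsp (g : ℕ) : Type := Fin (2 * g) → ℚ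

/-- The tensor algebra `T = T(H)`. -/
abbrev TA (g : ℕ) : Type := TensorAlgebra ℚ (Hsp g)

/-- The antipode `x ↦ x̄`, determined by `overline (u₁⋯u_m) = (−1)^m u_m⋯u₁`. -/
def barT (g : ℕ) : TA g →ₗ[ℚ] TA g :=
  (MulOpposite.opLinearEquiv ℚ (M := TA g)).symm.toLinearMap ∘ₗ
    (TensorAlgebra.lift ℚ
      ((MulOpposite.opLinearEquiv ℚ (M := TA g)).toLinearMap ∘ₗ
        (-(TensorAlgebra.ι ℚ (M := Hsp g))))).toLinearMap

/-- The coproduct `Δ : T → T ⊗ T`, the algebra homomorphism with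
`Δ(u) = u ⊗ 1 + 1 ⊗ u` for `u ∈ H`. -/
def comul (g : ℕ) : TA g →ₗ[ℚ] TA g ⊗[ℚ] TA g :=
  (TensorAlgebra.lift ℚ
    (((TensorProduct.mk ℚ (TA g) (TA g)).flip 1) ∘ₗ TensorAlgebra.ι ℚ
      + (TensorProduct.mk ℚ (TA g) (TA g) 1) ∘ₗ TensorAlgebra.ι ℚ)).toLinearMap

/-- `T ⊗ T ⊗ T ⊗ T`. -/
abbrev T4 (g : ℕ) : Type := TA g ⊗[ℚ] (TA g ⊗[ℚ] (TA g ⊗[ℚ] TA g))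

/-- The generator `Θ(t,u,v,w)`, i.e. `t ⊗ u ⊗ v ⊗ w`. -/
def Th (g : ℕ) (t u v w : TA g) : T4 g := t ⊗ₜ[ℚ] (u ⊗ₜ[ℚ] (v ⊗ₜ[ℚ] w))

/-- The second term `Θ(t̄′, t″u, v̄′, wv″)` of the (GC3) relation
(Sweedler summation implicit). -/
def gc3B (g : ℕ) (t u v w : TA g) : T4 g :=
  (TensorProduct.assoc ℚ (TA g) (TA g) (TA g ⊗[ℚ] TA g))
    ((TensorProduct.map (barT g) (LinearMap.mulRight ℚ u)) (comul g t) ⊗ₜ[ℚ]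
     (TensorProduct.map (barT g) (LinearMap.mulLeft ℚ w)) (comul g v))

/-- The third term `Θ(tu″, ū′, w″v, w̄′)` of the (GC3) relation
(Sweedler summation implicit). -/
def gc3C (g : ℕ) (t u v w : TA g) : T4 g :=
  (TensorProduct.assoc ℚ (TA g) (TA g) (TA g ⊗[ℚ] TA g))
    ((TensorProduct.comm ℚ (TA g) (TA g)
        ((TensorProduct.map (barT g) (LinearMap.mulLeft ℚ t)) (comul g u))) ⊗ₜ[ℚ]
     (TensorProduct.comm ℚ (TA g) (TA g)
        ((TensorProduct.map (barT g) (LinearMap.mulRight ℚ v)) (comul g w))))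

/-- The full (GC3) element `Θ(t,u,v,w) + Θ(t̄′,t″u,v̄′,wv″) + Θ(tu″,ū′,w″v,w̄′)`. -/
def gc3 (g : ℕ) (t u v w : TA g) : T4 g :=
  Th g t u v w + gc3B g t u v w + gc3C g t u v w

/-- The relations (CS), (HB) and (GC3) defining `Ω̃₂`. -/
def OmegaRel (g : ℕ) : Set (T4 g) :=
  {x | (∃ t u v w : TA g,
          x = Th g t u v w - Th g (barT g v) (barT g w) (barT g t) (barT g u)) ∨
       (∃ t u v w : TA g,
          x = Th g t u v w - Th g (barT g u) (barT g t) (barT g w) (barT g v)) ∨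
       (∃ (t u v w : TA g) (a : Hsp g),
          x = Th g t u v (w * TensorAlgebra.ι ℚ a)
              - Th g t u (TensorAlgebra.ι ℚ a * v) w
              - Th g t (TensorAlgebra.ι ℚ a * u) v w
              + Th g (t * TensorAlgebra.ι ℚ a) u v w) ∨
       (∃ t u v w : TA g, x = gc3 g t u v w)}

/-- The 2-loop space `Ω̃₂`. -/
abbrev Omega2 (g : ℕ) : Type := T4 g ⧸ Submodule.span ℚ (OmegaRel g)

/-- The class `Θ(t,u,v,w) ∈ Ω̃₂`. -/
def ThO (g : ℕ) (t u v w : TA g) : Omega2 g := Submodule.Quotient.mk (Th g t u v w)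

/-- The antipode is an anti-homomorphism. -/
theorem barT_mul (g : ℕ) (x y : TA g) : barT g (x * y) = barT g y * barT g x := by
  simp [barT]

theorem barT_one (g : ℕ) : barT g 1 = 1 := by
  simp [barT]

theorem barT_ι (g : ℕ) (a : Hsp g) :
    barT g (TensorAlgebra.ι ℚ a) = -TensorAlgebra.ι ℚ a := by
  simp [barT]

theorem comul_mul (g : ℕ) (x y : TA g) : comul g (x * y) = comul g x * comul g y := by
  simp [comul]

theorem comul_one (g : ℕ) : comul g 1 = 1 ⊗ₜ[ℚ] 1 := by
  simp [comul, Algebra.TensorProduct.one_def]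

theorem comul_ι (g : ℕ) (a : Hsp g) :
    comul g (TensorAlgebra.ι ℚ a) =
      TensorAlgebra.ι ℚ a ⊗ₜ[ℚ] 1 + 1 ⊗ₜ[ℚ] TensorAlgebra.ι ℚ a := by
  simp [comul]

/-- The class in `Ω̃₂` as a function of the strand pairs `(t, u)` and `(v, w)`,
with the antipode applied to the first entry of each pair. -/
def barPairClass (g : ℕ) (X Y : TA g ⊗[ℚ] TA g) : Omega2 g :=
  (Submodule.span ℚ (OmegaRel g)).mkQ
    ((TensorProduct.assoc ℚ (TA g) (TA g) (TA g ⊗[ℚ] TA g))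
      ((TensorProduct.map (barT g) LinearMap.id) X ⊗ₜ[ℚ]
        (TensorProduct.map (barT g) LinearMap.id) Y))

theorem barPairClass_tmul (g : ℕ) (x y p q : TA g) :
    barPairClass g (x ⊗ₜ[ℚ] y) (p ⊗ₜ[ℚ] q) = ThO g (barT g x) y (barT g p) q := by
  simp [barPairClass, ThO, Th]

theorem barPairClass_add_left (g : ℕ) (X X' Y : TA g ⊗[ℚ] TA g) :
    barPairClass g (X + X') Y = barPairClass g X Y + barPairClass g X' Y := by
  simp only [barPairClass, map_add, TensorProduct.add_tmul]

theorem barPairClass_add_right (g : ℕ) (X Y Y' : TA g ⊗[ℚ] TA g) :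
    barPairClass g X (Y + Y') = barPairClass g X Y + barPairClass g X Y' := by
  simp only [barPairClass, map_add, TensorProduct.tmul_add]

theorem barPairClass_zero_left (g : ℕ) (Y : TA g ⊗[ℚ] TA g) : barPairClass g 0 Y = 0 := by
  simp only [barPairClass, map_zero, TensorProduct.zero_tmul]

theorem barPairClass_zero_right (g : ℕ) (X : TA g ⊗[ℚ] TA g) : barPairClass g X 0 = 0 := by
  simp only [barPairClass, map_zero, TensorProduct.tmul_zero]

theorem ThO_neg_first (g : ℕ) (t u v w : TA g) : ThO g (-t) u v w = -ThO g t u v w := by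
  simp only [ThO, Th, TensorProduct.neg_tmul, Submodule.Quotient.mk_neg]

theorem ThO_neg_third (g : ℕ) (t u v w : TA g) : ThO g t u (-v) w = -ThO g t u v w := by
  simp only [ThO, Th, TensorProduct.neg_tmul, TensorProduct.tmul_neg, Submodule.Quotient.mk_neg]

/-- The (HB) relation in `Ω̃₂`. -/
theorem ThO_hb (g : ℕ) (t u v w : TA g) (a : Hsp g) :
    ThO g t u v (w * TensorAlgebra.ι ℚ a) - ThO g t u (TensorAlgebra.ι ℚ a * v) w
      - ThO g t (TensorAlgebra.ι ℚ a * u) v w + ThO g (t * TensorAlgebra.ι ℚ a) u v w = 0 :=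
  (Submodule.Quotient.mk_eq_zero _).2
    (Submodule.subset_span (Or.inr (Or.inr (Or.inl ⟨t, u, v, w, a, rfl⟩))))

/-- The (GC3) relation for trivial `u` and `w`. -/
theorem two_ThO_add_barPairClass (g : ℕ) (t v : TA g) :
    (2 : ℚ) • ThO g t 1 v 1 + barPairClass g (comul g t) (comul g v) = 0 := by
  have h : (Submodule.span ℚ (OmegaRel g)).mkQ (gc3 g t 1 v 1) = 0 :=
    (Submodule.Quotient.mk_eq_zero _).2
      (Submodule.subset_span (Or.inr (Or.inr (Or.inr ⟨t, 1, v, 1, rfl⟩))))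
  have hB : (Submodule.span ℚ (OmegaRel g)).mkQ (gc3B g t 1 v 1) =
      barPairClass g (comul g t) (comul g v) := by
    simp only [gc3B, barPairClass, LinearMap.mulRight_one, LinearMap.mulLeft_one]
  have hC : gc3C g t 1 v 1 = Th g t 1 v 1 := by
    simp [gc3C, Th, comul_one, barT_one]
  have hT : (Submodule.span ℚ (OmegaRel g)).mkQ (Th g t 1 v 1) = ThO g t 1 v 1 := rfl
  rw [gc3, map_add, map_add, hB, hC, hT] at h
  rw [two_smul, ← h]
  abel

/-- Multiplication by a primitive element slides between the two strand pairs. -/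
theorem barPairClass_slide (g : ℕ) (a : Hsp g) (X Y : TA g ⊗[ℚ] TA g) :
    barPairClass g (comul g (TensorAlgebra.ι ℚ a) * X) Y =
      barPairClass g X (Y * comul g (TensorAlgebra.ι ℚ a)) := by
  induction X using TensorProduct.induction_on with
  | zero => simp only [mul_zero, barPairClass_zero_left]
  | add X X' hX hX' => simp only [mul_add, barPairClass_add_left, hX, hX']
  | tmul x y =>
    induction Y using TensorProduct.induction_on with
    | zero => simp only [zero_mul, barPairClass_zero_right]
    | add Y Y' hY hY' => simp only [add_mul, barPairClass_add_right, hY, hY']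
    | tmul p q =>
      have h := ThO_hb g (barT g x) y (barT g p) q a
      simp only [comul_ι, add_mul, mul_add, Algebra.TensorProduct.tmul_mul_tmul, one_mul, mul_one,
        barPairClass_add_left, barPairClass_add_right, barPairClass_tmul, barT_mul, barT_ι,
        mul_neg, neg_mul, ThO_neg_first, ThO_neg_third]
      rw [← sub_eq_zero, ← neg_eq_zero, ← h]
      abel

theorem ThO_slide_ι (g : ℕ) (t v : TA g) (a : Hsp g) :
    ThO g t 1 (v * TensorAlgebra.ι ℚ a) 1 = ThO g (TensorAlgebra.ι ℚ a * t) 1 v 1 := by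
  have h₁ := two_ThO_add_barPairClass g t (v * TensorAlgebra.ι ℚ a)
  have h₂ := two_ThO_add_barPairClass g (TensorAlgebra.ι ℚ a * t) v
  rw [comul_mul, ← barPairClass_slide] at h₁
  rw [comul_mul] at h₂
  exact smul_right_injective _ (two_ne_zero (α := ℚ)) (add_right_cancel (h₁.trans h₂.symm))

/-- Lemma 3.2(2) transported through the presentation of `Ω̃₂`:
a hair bundle on the left cycle of a theta graph may be slid from the top
strand to the bottom strand: `Θ(t,1,va,1) = Θ(at,1,v,1)` in `Ω̃₂`. -/
theorem theta_slide_left_cycle (g : ℕ) (hg : 1 ≤ g) (t v a : TA g) :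
    ThO g t 1 (v * a) 1 = ThO g (a * t) 1 v 1 := by
  induction a using TensorAlgebra.induction generalizing t v with
  | algebraMap r =>
    simp only [Algebra.algebraMap_eq_smul_one, mul_smul_comm, smul_mul_assoc, mul_one, one_mul,
      ThO, Th]
    rw [← TensorProduct.smul_tmul', TensorProduct.tmul_smul, TensorProduct.tmul_smul,
      ← TensorProduct.smul_tmul']
  | ι a => exact ThO_slide_ι g t v a
  | mul a b ha hb => rw [← mul_assoc, hb, ha, mul_assoc]
  | add a b ha hb =>
    have hl : ThO g t 1 (v * (a + b)) 1 = ThO g t 1 (v * a) 1 + ThO g t 1 (v * b) 1 := by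
      simp only [ThO, Th, mul_add, TensorProduct.add_tmul, TensorProduct.tmul_add,
        Submodule.Quotient.mk_add]
    have hr : ThO g ((a + b) * t) 1 v 1 = ThO g (a * t) 1 v 1 + ThO g (b * t) 1 v 1 := by
      simp only [ThO, Th, add_mul, TensorProduct.add_tmul, Submodule.Quotient.mk_add]
    rw [hl, hr, ha, hb]
end
end

section
/- The ℚ-linear map (T⊗T⊗T⊗T) ⊕ (T⊗T⊗T⊗T) → T⊗T⊗T⊗T sending (x, 0) ↦ x and (0, t⊗u⊗v⊗w) ↦ t⊗u⊗v⊗w + v̄⊗u⊗t̄⊗w descends to a well-defined ℚ-linear isomorphism from C₁₂ / span{GC3(t,u,v,w) : t,u,v,w ∈ T} onto Ω̃₂, carrying the class of Θ(t,u,v,w) to Θ(t,u,v,w) and the class of D(t,u,v,w) to Θ(t,u,v,w) + Θ(v̄,u,t̄,w). (Combination of Theorem 1.1 and Theorem 3.1 of the paper: the 2-loop space Ω̃₂ is the quotient of C_{1,2}ℋ by the generalized Conant third relation, with the dumbbell generators eliminated by the core-change relation.) -/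
open TensorProduct

set_option maxSynthPendingDepth 4

noncomputable section

/-- The presentation space for `C_{1,2}ℋ`: one copy of `T⊗T⊗T⊗T` for the theta
generators and one for the dumbbell generators. -/
abbrev P2 (g : ℕ) : Type := T4 g × T4 g

/-- The theta generator in the presentation space. -/
def ThP (g : ℕ) (t u v w : TA g) : P2 g := (Th g t u v w, 0)

/-- The dumbbell generator in the presentation space. -/
def DP (g : ℕ) (t u v w : TA g) : P2 g := (0, Th g t u v w)

/-- The relations (CS), (HB) and (CC) defining `C₁₂ = C_{1,2}ℋ`. -/
def C12Rel (g : ℕ) : Set (P2 g) :=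
  {x | (∃ t u v w : TA g,
          x = ThP g t u v w - ThP g (barT g v) (barT g w) (barT g t) (barT g u)) ∨
       (∃ t u v w : TA g,
          x = ThP g t u v w - ThP g (barT g u) (barT g t) (barT g w) (barT g v)) ∨
       (∃ t u v w : TA g,
          x = DP g t u v w - DP g (barT g v) u (barT g t) w) ∨
       (∃ t u v w : TA g,
          x = DP g t u v w - DP g (barT g u) (barT g t) (barT g w) (barT g v)) ∨
       (∃ (t u v w : TA g) (a : Hsp g),
          x = ThP g t u v (w * TensorAlgebra.ι ℚ a)
              - ThP g t u (TensorAlgebra.ι ℚ a * v) w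
              - ThP g t (TensorAlgebra.ι ℚ a * u) v w
              + ThP g (t * TensorAlgebra.ι ℚ a) u v w) ∨
       (∃ (t u v w : TA g) (a : Hsp g),
          x = DP g t u (TensorAlgebra.ι ℚ a * v) w
              - DP g (t * TensorAlgebra.ι ℚ a) u v w
              - DP g t u v (w * TensorAlgebra.ι ℚ a)
              + DP g t (TensorAlgebra.ι ℚ a * u) v w) ∨
       (∃ t u v w : TA g,
          x = DP g t u v w - ThP g t u v w - ThP g (barT g v) u (barT g t) w)}

/-- The space `C₁₂ = C_{1,2}ℋ`. -/
abbrev C12 (g : ℕ) : Type := P2 g ⧸ Submodule.span ℚ (C12Rel g)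

/-- The class `Θ(t,u,v,w) ∈ C₁₂`. -/
def ThC (g : ℕ) (t u v w : TA g) : C12 g := Submodule.Quotient.mk (ThP g t u v w)

/-- The class `D(t,u,v,w) ∈ C₁₂`. -/
def DC (g : ℕ) (t u v w : TA g) : C12 g := Submodule.Quotient.mk (DP g t u v w)

/-- The element `GC3(t,u,v,w) ∈ C₁₂`. -/
def gc3C12 (g : ℕ) (t u v w : TA g) : C12 g :=
  Submodule.Quotient.mk ((gc3 g t u v w, 0) : P2 g)

/-- The linear map `T⊗T⊗T⊗T → T⊗T⊗T⊗T`, `t⊗u⊗v⊗w ↦ v⊗u⊗t⊗w`. -/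
def swap13 (g : ℕ) : T4 g →ₗ[ℚ] T4 g :=
  (TensorProduct.leftComm ℚ (TA g) (TA g) (TA g ⊗[ℚ] TA g)).toLinearMap ∘ₗ
    (TensorProduct.map LinearMap.id
      (TensorProduct.leftComm ℚ (TA g) (TA g) (TA g)).toLinearMap) ∘ₗ
    (TensorProduct.leftComm ℚ (TA g) (TA g) (TA g ⊗[ℚ] TA g)).toLinearMap

/-- The linear map `t⊗u⊗v⊗w ↦ v̄⊗u⊗t̄⊗w`. -/
def psiD (g : ℕ) : T4 g →ₗ[ℚ] T4 g :=
  swap13 g ∘ₗ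
    (TensorProduct.map (barT g)
      (TensorProduct.map LinearMap.id (TensorProduct.map (barT g) LinearMap.id)))

/-- The linear map `(T⊗T⊗T⊗T) ⊕ (T⊗T⊗T⊗T) → T⊗T⊗T⊗T` sending `(x,0) ↦ x` and
`(0, t⊗u⊗v⊗w) ↦ t⊗u⊗v⊗w + v̄⊗u⊗t̄⊗w`. -/
def PhiCC (g : ℕ) : P2 g →ₗ[ℚ] T4 g :=
  LinearMap.coprod LinearMap.id (LinearMap.id + psiD g)

/-- The quotient `C₁₂ / span{GC3(t,u,v,w)}`. -/
abbrev C12modGC3 (g : ℕ) : Type :=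
  C12 g ⧸ Submodule.span ℚ {x : C12 g | ∃ t u v w : TA g, x = gc3C12 g t u v w}

theorem barT_barT (g : ℕ) (x : TA g) : barT g (barT g x) = x := by
  induction x using TensorAlgebra.induction with
  | algebraMap r => simp [Algebra.algebraMap_eq_smul_one, barT_one]
  | ι a => simp [barT_ι]
  | mul x y hx hy => simp [barT_mul, hx, hy]
  | add x y hx hy => simp [hx, hy]

theorem psiD_Th (g : ℕ) (t u v w : TA g) :
    psiD g (Th g t u v w) = Th g (barT g v) u (barT g t) w := by
  simp [psiD, swap13, Th]

theorem PhiCC_ThP (g : ℕ) (t u v w : TA g) : PhiCC g (ThP g t u v w) = Th g t u v w := by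
  simp [PhiCC, ThP]

theorem PhiCC_DP (g : ℕ) (t u v w : TA g) :
    PhiCC g (DP g t u v w) = Th g t u v w + Th g (barT g v) u (barT g t) w := by
  simp [PhiCC, DP, psiD_Th]

theorem Th_neg_left (g : ℕ) (t u v w : TA g) : Th g (-t) u v w = -Th g t u v w := by
  simp [Th, TensorProduct.neg_tmul]

theorem Th_neg_third (g : ℕ) (t u v w : TA g) : Th g t u (-v) w = -Th g t u v w := by
  simp [Th, TensorProduct.neg_tmul, TensorProduct.tmul_neg]

/-- Every relation of `C₁₂` is sent by `PhiCC` into the relations of `Ω̃₂`. -/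
theorem span_C12Rel_le_comap_PhiCC (g : ℕ) :
    Submodule.span ℚ (C12Rel g) ≤ (Submodule.span ℚ (OmegaRel g)).comap (PhiCC g) := by
  have rotate (t u v w : TA g) :
      Th g t u v w - Th g (barT g v) (barT g w) (barT g t) (barT g u)
        ∈ Submodule.span ℚ (OmegaRel g) :=
    Submodule.subset_span (Or.inl ⟨t, u, v, w, rfl⟩)
  have reflect (t u v w : TA g) :
      Th g t u v w - Th g (barT g u) (barT g t) (barT g w) (barT g v)
        ∈ Submodule.span ℚ (OmegaRel g) :=
    Submodule.subset_span (Or.inr (Or.inl ⟨t, u, v, w, rfl⟩))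
  have slide (t u v w : TA g) (a : Hsp g) :
      Th g t u v (w * TensorAlgebra.ι ℚ a) - Th g t u (TensorAlgebra.ι ℚ a * v) w
        - Th g t (TensorAlgebra.ι ℚ a * u) v w + Th g (t * TensorAlgebra.ι ℚ a) u v w
        ∈ Submodule.span ℚ (OmegaRel g) :=
    Submodule.subset_span (Or.inr (Or.inr (Or.inl ⟨t, u, v, w, a, rfl⟩)))
  rw [Submodule.span_le]
  rintro x (⟨t, u, v, w, rfl⟩ | ⟨t, u, v, w, rfl⟩ | ⟨t, u, v, w, rfl⟩ | ⟨t, u, v, w, rfl⟩ |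
    ⟨t, u, v, w, a, rfl⟩ | ⟨t, u, v, w, a, rfl⟩ | ⟨t, u, v, w, rfl⟩) <;>
  simp only [SetLike.mem_coe, Submodule.mem_comap, map_sub, map_add, PhiCC_ThP, PhiCC_DP,
    barT_barT, barT_mul, barT_ι, mul_neg, neg_mul, Th_neg_left, Th_neg_third]
  · exact rotate t u v w
  · exact reflect t u v w
  · convert Submodule.zero_mem _ using 1
    abel
  · have hrotate := rotate (barT g v) u (barT g t) w
    have hreflect := reflect t (barT g w) v (barT g u)
    simp only [barT_barT] at hrotate hreflect
    convert add_mem (reflect t u v w) (add_mem hrotate hreflect) using 1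
    abel
  · exact slide t u v w a
  · convert neg_mem (add_mem (slide t u v w a) (slide (barT g v) u (barT g t) w a)) using 1
    abel
  · convert Submodule.zero_mem _ using 1
    abel

/-- Modulo the core-change relation, every element of the presentation space is equal to
the theta element given by its image under `PhiCC`. -/
theorem inl_PhiCC_sub_mem (g : ℕ) (p : P2 g) :
    ((PhiCC g p, 0) : P2 g) - p ∈ Submodule.span ℚ (C12Rel g) := by
  obtain ⟨x, y⟩ := p
  have hy : ((y + psiD g y, -y) : P2 g) ∈ Submodule.span ℚ (C12Rel g) := by
    have hle : (⊤ : Submodule ℚ (T4 g)) ≤ (Submodule.span ℚ (C12Rel g)).comap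
        ((LinearMap.id + psiD g).prod (-LinearMap.id)) := by
      have pure (t u v w : TA g) : Th g t u v w ∈ (Submodule.span ℚ (C12Rel g)).comap
          ((LinearMap.id + psiD g).prod (-LinearMap.id)) := by
        have hcc : DP g t u v w - ThP g t u v w - ThP g (barT g v) u (barT g t) w
            ∈ Submodule.span ℚ (C12Rel g) :=
          Submodule.subset_span
            (Or.inr (Or.inr (Or.inr (Or.inr (Or.inr (Or.inr ⟨t, u, v, w, rfl⟩))))))
        rw [Submodule.mem_comap]
        convert neg_mem hcc using 1
        ext1 <;> simp [DP, ThP, psiD_Th]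
        abel
      intro z _
      induction z using TensorProduct.induction_on with
      | zero => exact zero_mem _
      | add a b ha hb => exact add_mem (ha trivial) (hb trivial)
      | tmul t r =>
        induction r using TensorProduct.induction_on with
        | zero => simp only [tmul_zero, zero_mem]
        | add a b ha hb => rw [tmul_add]; exact add_mem (ha trivial) (hb trivial)
        | tmul u r =>
          induction r using TensorProduct.induction_on with
          | zero => simp only [tmul_zero, zero_mem]
          | add a b ha hb => rw [tmul_add, tmul_add]; exact add_mem (ha trivial) (hb trivial)
          | tmul v w => exact pure t u v w
    exact hle (x := y) trivial
  convert hy using 1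
  ext1 <;> simp [PhiCC]

/-- The map `C₁₂ → Ω̃₂` induced by `PhiCC`. -/
def c12ToOmega (g : ℕ) : C12 g →ₗ[ℚ] Omega2 g :=
  Submodule.mapQ _ _ (PhiCC g) (span_C12Rel_le_comap_PhiCC g)

theorem span_gc3C12_le_ker (g : ℕ) :
    Submodule.span ℚ {x : C12 g | ∃ t u v w : TA g, x = gc3C12 g t u v w}
      ≤ LinearMap.ker (c12ToOmega g) := by
  rw [Submodule.span_le]
  rintro x ⟨t, u, v, w, rfl⟩
  rw [SetLike.mem_coe, LinearMap.mem_ker]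
  refine (Submodule.Quotient.mk_eq_zero _).2 ?_
  have hPhi : PhiCC g (gc3 g t u v w, 0) = gc3 g t u v w := by simp [PhiCC]
  rw [hPhi]
  exact Submodule.subset_span (Or.inr (Or.inr (Or.inr ⟨t, u, v, w, rfl⟩)))

/-- The inclusion of theta elements, as a map to `C₁₂ / span{GC3}`. -/
def thetaIncl (g : ℕ) : T4 g →ₗ[ℚ] C12modGC3 g :=
  Submodule.mkQ _ ∘ₗ Submodule.mkQ _ ∘ₗ LinearMap.inl ℚ (T4 g) (T4 g)

theorem thetaIncl_apply (g : ℕ) (x : T4 g) :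
    thetaIncl g x
      = Submodule.Quotient.mk (Submodule.Quotient.mk ((x, 0) : P2 g)) := rfl

theorem span_OmegaRel_le_ker (g : ℕ) :
    Submodule.span ℚ (OmegaRel g) ≤ LinearMap.ker (thetaIncl g) := by
  have of_mem {x : T4 g} (hx : ((x, 0) : P2 g) ∈ C12Rel g) : thetaIncl g x = 0 := by
    rw [thetaIncl_apply, (Submodule.Quotient.mk_eq_zero _).2 (Submodule.subset_span hx),
      Submodule.Quotient.mk_zero]
  rw [Submodule.span_le]
  rintro x (⟨t, u, v, w, rfl⟩ | ⟨t, u, v, w, rfl⟩ | ⟨t, u, v, w, a, rfl⟩ | ⟨t, u, v, w, rfl⟩) <;>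
  rw [SetLike.mem_coe, LinearMap.mem_ker]
  · exact of_mem (Or.inl ⟨t, u, v, w, by simp [ThP]⟩)
  · exact of_mem (Or.inr (Or.inl ⟨t, u, v, w, by simp [ThP]⟩))
  · exact of_mem
      (Or.inr (Or.inr (Or.inr (Or.inr (Or.inl ⟨t, u, v, w, a, by simp [ThP]⟩)))))
  · exact (Submodule.Quotient.mk_eq_zero _).2 (Submodule.subset_span ⟨t, u, v, w, rfl⟩)

/-- The isomorphism `C₁₂ / span{GC3} ≅ Ω̃₂` induced by `PhiCC`. -/
def c12ModGC3EquivOmega2 (g : ℕ) : C12modGC3 g ≃ₗ[ℚ] Omega2 g :=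
  LinearEquiv.ofLinearMap
    (Submodule.liftQ _ (c12ToOmega g) (span_gc3C12_le_ker g))
    (Submodule.liftQ _ (thetaIncl g) (span_OmegaRel_le_ker g))
    (by
      refine LinearMap.ext fun y => ?_
      obtain ⟨x, rfl⟩ := Submodule.Quotient.mk_surjective _ y
      change (Submodule.Quotient.mk (PhiCC g (x, 0)) : Omega2 g) = Submodule.Quotient.mk x
      simp [PhiCC])
    (by
      refine LinearMap.ext fun y => ?_
      obtain ⟨y, rfl⟩ := Submodule.Quotient.mk_surjective _ y
      obtain ⟨p, rfl⟩ := Submodule.Quotient.mk_surjective _ y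
      change thetaIncl g (PhiCC g p) = Submodule.Quotient.mk (Submodule.Quotient.mk p)
      rw [thetaIncl_apply, (Submodule.Quotient.eq _).2 (inl_PhiCC_sub_mem g p)])

theorem c12ModGC3EquivOmega2_mk (g : ℕ) (p : P2 g) :
    c12ModGC3EquivOmega2 g (Submodule.Quotient.mk (Submodule.Quotient.mk p))
      = Submodule.Quotient.mk (PhiCC g p) := rfl

/-- Combination of Theorem 1.1 and Theorem 3.1: the map `(x,0) ↦ x`,
`(0,t⊗u⊗v⊗w) ↦ t⊗u⊗v⊗w + v̄⊗u⊗t̄⊗w` descends to a well-defined linear isomorphism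
`C₁₂ / span{GC3} ≅ Ω̃₂`, carrying the class of `Θ(t,u,v,w)` to `Θ(t,u,v,w)` and the
class of `D(t,u,v,w)` to `Θ(t,u,v,w) + Θ(v̄,u,t̄,w)`. -/
theorem c12_mod_gc3_iso_omega2 (g : ℕ) (hg : 1 ≤ g) :
    ∃ e : C12modGC3 g ≃ₗ[ℚ] Omega2 g,
      (∀ p : P2 g,
        e (Submodule.Quotient.mk (Submodule.Quotient.mk p))
          = Submodule.Quotient.mk (PhiCC g p)) ∧
      (∀ t u v w : TA g,
        e (Submodule.Quotient.mk (ThC g t u v w)) = ThO g t u v w) ∧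
      (∀ t u v w : TA g,
        e (Submodule.Quotient.mk (DC g t u v w))
          = ThO g t u v w + ThO g (barT g v) u (barT g t) w) := by
  refine ⟨c12ModGC3EquivOmega2 g, c12ModGC3EquivOmega2_mk g, fun t u v w => ?_,
    fun t u v w => ?_⟩
  · rw [ThC, c12ModGC3EquivOmega2_mk, PhiCC_ThP, ThO]
  · rw [DC, c12ModGC3EquivOmega2_mk, PhiCC_DP, ThO, ThO, Submodule.Quotient.mk_add]
end
end
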